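/- arXiv:1904.12713 — 3 statements merged into one kernel-verified Lean document; each statement's English description precedes it below -/
import Mathlib

section
/- Let θ > 0 and let v : ℝ⁴ → ℝ be measurable with |v(y)| ≤ C(1+|y|)^{−(2+θ)} for all y, and let f : ℝ⁴ → ℝ be measurable with (1+|·|)^{−s} f ∈ L²(ℝ⁴) for every s > 0. Define, for |x| ≥ 4, g₂(x) = ∫_{{y : |x−y| ≥ 2 and |y| > |x|^{1/2}}} v(y) f(y) |x−y|^{−2} dy. Then ∫_{{|x| ≥ 4}} |g₂(x)|² dx < ∞. -/
open MeasureTheory Real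
open scoped ENNReal

noncomputable section

/-- A product of negative powers is controlled by the decay of either factor alone. -/
lemma sq_rpow_mul_rpow_le {a p q : ℝ} (ha : 0 < a) (hp : 1 ≤ p) (hq : 1 ≤ q) :
    (q ^ (-2 : ℝ) * p ^ (-a)) ^ 2 ≤
      2 ^ (4 + 2 * a) * ((1 + p) ^ (-(4 + 2 * a)) + (1 + q) ^ (-(4 + 2 * a))) := by
  have key : ∀ m : ℝ, 1 ≤ m → m ≤ p → m ≤ q →
      (q ^ (-2 : ℝ) * p ^ (-a)) ^ 2 ≤ 2 ^ (4 + 2 * a) * (1 + m) ^ (-(4 + 2 * a)) := by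
    intro m hm hmp hmq
    have hm0 : 0 < m := by linarith
    have h1 : q ^ (-2 : ℝ) ≤ m ^ (-2 : ℝ) :=
      rpow_le_rpow_of_nonpos hm0 hmq (by norm_num)
    have h2 : p ^ (-a) ≤ m ^ (-a) := rpow_le_rpow_of_nonpos hm0 hmp (by linarith)
    have hp0 : 0 ≤ p ^ (-a) := rpow_nonneg (by linarith) _
    have hq0 : 0 ≤ q ^ (-2 : ℝ) := rpow_nonneg (by linarith) _
    calc (q ^ (-2 : ℝ) * p ^ (-a)) ^ 2 ≤ (m ^ (-2 : ℝ) * m ^ (-a)) ^ 2 := by gcongr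
      _ = m ^ (-(4 + 2 * a)) := by
        rw [← rpow_add hm0, ← rpow_mul_natCast hm0.le]
        congr 1
        push_cast
        ring
      _ ≤ ((1 + m) / 2) ^ (-(4 + 2 * a)) :=
        rpow_le_rpow_of_nonpos (by linarith) (by linarith) (by linarith)
      _ = 2 ^ (4 + 2 * a) * (1 + m) ^ (-(4 + 2 * a)) := by
        rw [div_rpow (by linarith) (by norm_num), rpow_neg (by norm_num : (0 : ℝ) ≤ 2),
          div_inv_eq_mul, mul_comm]
  have hp' : 0 ≤ (1 + p) ^ (-(4 + 2 * a)) := rpow_nonneg (by linarith) _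
  have hq' : 0 ≤ (1 + q) ^ (-(4 + 2 * a)) := rpow_nonneg (by linarith) _
  rcases le_total p q with h | h
  · refine (key p hp le_rfl h).trans ?_
    gcongr
    linarith
  · refine (key q hq h le_rfl).trans ?_
    gcongr
    linarith

/-- Cauchy–Schwarz for the measure with density `W`. -/
lemma sq_lintegral_mul_le {α : Type*} [MeasurableSpace α] (μ : Measure α) {W k : α → ℝ≥0∞}
    (hW : Measurable W) (hk : Measurable k) :
    (∫⁻ y, W y * k y ∂μ) ^ 2 ≤ (∫⁻ y, W y ∂μ) * ∫⁻ y, W y * k y ^ 2 ∂μ := by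
  have hsq : ∀ t : ℝ≥0∞, (t ^ (1 / 2 : ℝ)) ^ 2 = t := fun t ↦ by
    rw [← ENNReal.rpow_mul_natCast]; norm_num
  have h := ENNReal.lintegral_mul_le_Lp_mul_Lq μ Real.HolderConjugate.two_two
    (hW.pow_const (1 / 2 : ℝ)).aemeasurable
    ((hW.pow_const (1 / 2 : ℝ)).mul hk).aemeasurable
  have e : ∀ y, W y ^ (1 / 2 : ℝ) * (W y ^ (1 / 2 : ℝ) * k y) = W y * k y := fun y ↦ by
    rw [← mul_assoc, ← sq, hsq]
  simp only [Pi.mul_apply, ENNReal.rpow_ofNat, mul_pow, hsq, e] at h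
  calc _ ≤ _ := pow_le_pow_left' h 2
    _ = _ := by rw [mul_pow, hsq, hsq]

/-- Inverse powers above the dimension have finite integral. -/
lemma lintegral_one_add_norm_rpow_lt_top {r : ℝ} (hr : 4 < r) :
    ∫⁻ x : EuclideanSpace ℝ (Fin 4), ENNReal.ofReal ((1 + ‖x‖) ^ (-r)) < ⊤ :=
  finite_integral_one_add_norm (by simpa using hr)

/-- The weighted potential term `v f` is integrable with room to spare. -/
lemma lintegral_weighted_lt_top {θ C : ℝ} (hθ : 0 < θ)
    {v f : EuclideanSpace ℝ (Fin 4) → ℝ}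
    (hvb : ∀ y, |v y| ≤ C * (1 + ‖y‖) ^ (-(2 + θ)))
    (hweight : ∀ s : ℝ, 0 < s →
      (∫⁻ y, ENNReal.ofReal ((f y) ^ 2 * (1 + ‖y‖) ^ (-(2 * s)))) < ⊤) :
    ∫⁻ y, ENNReal.ofReal (|v y * f y| * (1 + ‖y‖) ^ (θ / 2)) < ⊤ := by
  have hC : 0 ≤ C := by simpa using (abs_nonneg _).trans (hvb 0)
  have hb : ∀ y, ENNReal.ofReal (|v y * f y| * (1 + ‖y‖) ^ (θ / 2)) ≤
      ENNReal.ofReal C * (ENNReal.ofReal ((f y) ^ 2 * (1 + ‖y‖) ^ (-(2 * (θ / 4)))) +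
        ENNReal.ofReal ((1 + ‖y‖) ^ (-(4 + θ / 2)))) := by
    intro y
    have h0 : 0 < 1 + ‖y‖ := by positivity
    rw [← ENNReal.ofReal_add (by positivity) (by positivity), ← ENNReal.ofReal_mul hC]
    refine ENNReal.ofReal_le_ofReal ?_
    set A := |f y| * (1 + ‖y‖) ^ (-(θ / 4))
    set B := (1 + ‖y‖) ^ (-(2 + θ / 4))
    have hA : A ^ 2 = (f y) ^ 2 * (1 + ‖y‖) ^ (-(2 * (θ / 4))) := by
      rw [mul_pow, sq_abs, ← rpow_mul_natCast h0.le]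
      congr 2
      push_cast
      ring
    have hB : B ^ 2 = (1 + ‖y‖) ^ (-(4 + θ / 2)) := by
      rw [← rpow_mul_natCast h0.le]
      congr 1
      push_cast
      ring
    rw [← hA, ← hB]
    have hA0 : 0 ≤ A := by positivity
    have hB0 : 0 ≤ B := by positivity
    calc |v y * f y| * (1 + ‖y‖) ^ (θ / 2)
        ≤ (C * (1 + ‖y‖) ^ (-(2 + θ)) * |f y|) * (1 + ‖y‖) ^ (θ / 2) := by
          rw [abs_mul]
          gcongr
          exact hvb y
      _ = C * (A * B) := by
          have : (1 + ‖y‖) ^ (-(2 + θ)) * (1 + ‖y‖) ^ (θ / 2) =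
              (1 + ‖y‖) ^ (-(θ / 4)) * (1 + ‖y‖) ^ (-(2 + θ / 4)) := by
            rw [← rpow_add h0, ← rpow_add h0]
            congr 1
            ring
          linear_combination C * |f y| * this
      _ ≤ C * (A ^ 2 + B ^ 2) := by
          gcongr
          nlinarith [sq_nonneg (A - B), mul_nonneg hA0 hB0]
  refine (lintegral_mono hb).trans_lt ?_
  rw [lintegral_const_mul' _ _ ENNReal.ofReal_ne_top, lintegral_add_right _ (by fun_prop)]
  exact ENNReal.mul_lt_top ENNReal.ofReal_lt_top (ENNReal.add_lt_top.2
    ⟨hweight _ (by positivity), lintegral_one_add_norm_rpow_lt_top (by linarith)⟩)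

/-- The far-field part `g₂` of the Green's-function integral is square
integrable on `{|x| ≥ 4}`: with `|v(y)| ≤ C (1+|y|)^{-(2+θ)}` and
`f ∈ L²_{-s}(ℝ⁴)` for every `s > 0`, the function
`g₂(x) = ∫_{|x-y| ≥ 2, |y| > |x|^{1/2}} v(y) f(y) |x-y|^{-2} dy`
satisfies `∫_{|x| ≥ 4} |g₂(x)|² dx < ∞`. -/
theorem far_field_green_part_square_integrable
    (θ C : ℝ) (hθ : 0 < θ) (hC : 0 < C)
    (v f : EuclideanSpace ℝ (Fin 4) → ℝ)
    (hv : Measurable v) (hf : Measurable f)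
    (hvb : ∀ y : EuclideanSpace ℝ (Fin 4), |v y| ≤ C * (1 + ‖y‖) ^ (-(2 + θ)))
    (hweight : ∀ s : ℝ, 0 < s →
      (∫⁻ y, ENNReal.ofReal ((f y) ^ 2 * (1 + ‖y‖) ^ (-(2 * s)))) < ⊤) :
    (∫⁻ x in {x : EuclideanSpace ℝ (Fin 4) | 4 ≤ ‖x‖},
        ENNReal.ofReal
          ((∫ y in {y : EuclideanSpace ℝ (Fin 4) |
              2 ≤ ‖x - y‖ ∧ ‖x‖ ^ ((1 : ℝ) / 2) < ‖y‖},
              v y * f y * ‖x - y‖ ^ (-2 : ℝ)) ^ 2)) < ⊤ := by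
  set a := θ / 4 with ha
  have ha0 : 0 < a := by positivity
  set c := 4 + 2 * a with hc
  set W : EuclideanSpace ℝ (Fin 4) → ℝ≥0∞ :=
    fun y ↦ ENNReal.ofReal (|v y * f y| * (1 + ‖y‖) ^ (θ / 2))
  set D : EuclideanSpace ℝ (Fin 4) → ℝ≥0∞ := fun x ↦ ENNReal.ofReal ((1 + ‖x‖) ^ (-c))
  set M : ℝ≥0∞ := ENNReal.ofReal (2 ^ c)
  have hWm : Measurable W := by fun_prop
  have hDm : Measurable D := by fun_prop
  have hW : ∫⁻ y, W y < ⊤ := lintegral_weighted_lt_top hθ hvb hweight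
  have hD : ∫⁻ x, D x < ⊤ := lintegral_one_add_norm_rpow_lt_top (by linarith)
  have hpt : ∀ x : EuclideanSpace ℝ (Fin 4), 4 ≤ ‖x‖ →
      ENNReal.ofReal ((∫ y in {y : EuclideanSpace ℝ (Fin 4) |
        2 ≤ ‖x - y‖ ∧ ‖x‖ ^ ((1 : ℝ) / 2) < ‖y‖}, v y * f y * ‖x - y‖ ^ (-2 : ℝ)) ^ 2) ≤
      (∫⁻ y, W y) * ∫⁻ y, W y * (M * (D x + D (x - y))) := by
    intro x hx
    set S := {y : EuclideanSpace ℝ (Fin 4) | 2 ≤ ‖x - y‖ ∧ ‖x‖ ^ ((1 : ℝ) / 2) < ‖y‖}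
    have hS : MeasurableSet S :=
      (measurableSet_le (f := fun _ ↦ (2 : ℝ)) (g := fun y ↦ ‖x - y‖)
        (by fun_prop) (by fun_prop)).inter
        (measurableSet_lt (f := fun _ ↦ ‖x‖ ^ ((1 : ℝ) / 2)) (g := fun y ↦ ‖y‖)
          (by fun_prop) (by fun_prop))
    set k : EuclideanSpace ℝ (Fin 4) → ℝ≥0∞ :=
      fun y ↦ ENNReal.ofReal (‖x - y‖ ^ (-2 : ℝ) * ‖x‖ ^ (-a))
    have hkm : Measurable k := by fun_prop
    have h1 : ∀ y ∈ S, ‖v y * f y * ‖x - y‖ ^ (-2 : ℝ)‖ₑ ≤ W y * k y := by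
      intro y hy
      have hx0 : 0 < ‖x‖ := by linarith
      have hxy : 1 ≤ (1 + ‖y‖) ^ (θ / 2) * ‖x‖ ^ (-a) := by
        rw [rpow_neg hx0.le, ← div_eq_mul_inv, one_le_div (by positivity)]
        calc ‖x‖ ^ a = (‖x‖ ^ ((1 : ℝ) / 2)) ^ (θ / 2) := by
              rw [← rpow_mul hx0.le, ha]
              congr 1
              ring
          _ ≤ (1 + ‖y‖) ^ (θ / 2) := by
              gcongr
              linarith [hy.2]
      rw [Real.enorm_eq_ofReal_abs, ← ENNReal.ofReal_mul (by positivity)]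
      refine ENNReal.ofReal_le_ofReal ?_
      rw [abs_mul, abs_of_nonneg (by positivity : 0 ≤ ‖x - y‖ ^ (-2 : ℝ))]
      calc |v y * f y| * ‖x - y‖ ^ (-2 : ℝ)
          ≤ |v y * f y| * ‖x - y‖ ^ (-2 : ℝ) * ((1 + ‖y‖) ^ (θ / 2) * ‖x‖ ^ (-a)) :=
            le_mul_of_one_le_right (by positivity) hxy
        _ = _ := by ring
    have h2 : ∀ y ∈ S, W y * k y ^ 2 ≤ W y * (M * (D x + D (x - y))) := by
      intro y hy
      gcongr
      rw [← ENNReal.ofReal_pow (by positivity), ← ENNReal.ofReal_add (by positivity)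
        (by positivity), ← ENNReal.ofReal_mul (by positivity)]
      exact ENNReal.ofReal_le_ofReal
        (sq_rpow_mul_rpow_le ha0 (by linarith) (by linarith [hy.1]))
    calc _ = ‖∫ y in S, v y * f y * ‖x - y‖ ^ (-2 : ℝ)‖ₑ ^ 2 := by
          rw [Real.enorm_eq_ofReal_abs, ← ENNReal.ofReal_pow (abs_nonneg _), sq_abs]
      _ ≤ (∫⁻ y in S, W y * k y) ^ 2 := by
          gcongr
          exact (enorm_integral_le_lintegral_enorm _).trans (setLIntegral_mono' hS h1)
      _ ≤ (∫⁻ y in S, W y) * ∫⁻ y in S, W y * k y ^ 2 := sq_lintegral_mul_le _ hWm hkm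
      _ ≤ (∫⁻ y, W y) * ∫⁻ y, W y * (M * (D x + D (x - y))) :=
          mul_le_mul' (setLIntegral_le_lintegral _ _)
            ((setLIntegral_mono' hS h2).trans (setLIntegral_le_lintegral _ _))
  have hinner : ∀ y, ∫⁻ x, W y * (M * (D x + D (x - y))) =
      W y * (M * ((∫⁻ x, D x) + ∫⁻ x, D x)) := by
    intro y
    rw [lintegral_const_mul _ (by fun_prop), lintegral_const_mul _ (by fun_prop),
      lintegral_add_left hDm, lintegral_sub_right_eq_self D y]
  calc _ ≤ ∫⁻ x in {x : EuclideanSpace ℝ (Fin 4) | 4 ≤ ‖x‖},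
        (∫⁻ y, W y) * ∫⁻ y, W y * (M * (D x + D (x - y))) :=
        setLIntegral_mono' (measurableSet_le (by fun_prop) (by fun_prop)) hpt
    _ ≤ ∫⁻ x, (∫⁻ y, W y) * ∫⁻ y, W y * (M * (D x + D (x - y))) :=
        setLIntegral_le_lintegral _ _
    _ = (∫⁻ y, W y) * ((∫⁻ y, W y) * (M * ((∫⁻ x, D x) + ∫⁻ x, D x))) := by
        rw [lintegral_const_mul' _ _ hW.ne, lintegral_lintegral_swap (by fun_prop)]
        simp_rw [hinner]
        rw [lintegral_mul_const _ hWm]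
    _ < ⊤ := ENNReal.mul_lt_top hW (ENNReal.mul_lt_top hW
        (ENNReal.mul_lt_top ENNReal.ofReal_lt_top (ENNReal.add_lt_top.2 ⟨hD, hD⟩)))
end
end

section
/- Let m₁, m₂, m₃ > 0, set m₁₂ = m₁m₂/(m₁+m₂) and m₂₃ = m₂m₃/(m₂+m₃), and define H⁰(p, p') = |p|²/(2m₂₃) + ⟨p, p'⟩/m₂ + |p'|²/(2m₁₂) for p, p' ∈ ℝ^d, d ≥ 1. Then for every κ, κ' ≥ 0 with κ + κ' = 1 there exists a constant c > 0, depending only on the masses and κ, such that H⁰(p, p') ≥ c |p|^{2κ} |p'|^{2κ'} for all p, p' ∈ ℝ^d. -/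
open scoped RealInnerProductSpace

noncomputable section

/-- Young-type lower bound for the three-body kinetic-energy form in Jacobi
momenta: for every splitting `κ + κ' = 1`, `κ, κ' ≥ 0`, one has
`H⁰(p, p') ≥ c |p|^{2κ} |p'|^{2κ'}` with a constant depending only on the
masses and `κ`. -/
theorem jacobi_kinetic_energy_young_lower_bound
    (d : ℕ) (hd : 1 ≤ d) (m₁ m₂ m₃ : ℝ) (hm₁ : 0 < m₁) (hm₂ : 0 < m₂) (hm₃ : 0 < m₃)
    (κ κ' : ℝ) (hκ : 0 ≤ κ) (hκ' : 0 ≤ κ') (hsum : κ + κ' = 1) :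
    ∃ c : ℝ, 0 < c ∧
      ∀ p p' : EuclideanSpace ℝ (Fin d),
        c * ‖p‖ ^ (2 * κ) * ‖p'‖ ^ (2 * κ') ≤
          ‖p‖ ^ 2 / (2 * (m₂ * m₃ / (m₂ + m₃))) + ⟪p, p'⟫ / m₂ +
            ‖p'‖ ^ 2 / (2 * (m₁ * m₂ / (m₁ + m₂))) := by
  refine ⟨min (1 / (2 * m₃)) (1 / (2 * m₁)), by positivity, fun p p' => ?_⟩
  set c := min (1 / (2 * m₃)) (1 / (2 * m₁))
  have hc0 : 0 ≤ c := by positivity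
  have hpow (x : EuclideanSpace ℝ (Fin d)) (r : ℝ) : ‖x‖ ^ (2 * r) = (‖x‖ ^ 2) ^ r := by
    rw [Real.rpow_mul (norm_nonneg x), Real.rpow_two]
  have young : ‖p‖ ^ (2 * κ) * ‖p'‖ ^ (2 * κ') ≤ κ * ‖p‖ ^ 2 + κ' * ‖p'‖ ^ 2 := by
    rw [hpow, hpow]
    exact Real.geom_mean_le_arith_mean2_weighted hκ hκ' (sq_nonneg _) (sq_nonneg _) hsum
  have hle : κ * ‖p‖ ^ 2 + κ' * ‖p'‖ ^ 2 ≤ ‖p‖ ^ 2 + ‖p'‖ ^ 2 :=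
    add_le_add (mul_le_of_le_one_left (sq_nonneg _) (by linarith))
      (mul_le_of_le_one_left (sq_nonneg _) (by linarith))
  have kinetic : ‖p‖ ^ 2 / (2 * (m₂ * m₃ / (m₂ + m₃))) + ⟪p, p'⟫ / m₂ +
      ‖p'‖ ^ 2 / (2 * (m₁ * m₂ / (m₁ + m₂))) =
      1 / (2 * m₃) * ‖p‖ ^ 2 + 1 / (2 * m₁) * ‖p'‖ ^ 2 + ‖p + p'‖ ^ 2 / (2 * m₂) := by
    rw [norm_add_sq_real]
    field_simp
    ring
  have hp : c * ‖p‖ ^ 2 ≤ 1 / (2 * m₃) * ‖p‖ ^ 2 :=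
    mul_le_mul_of_nonneg_right (min_le_left _ _) (sq_nonneg _)
  have hp' : c * ‖p'‖ ^ 2 ≤ 1 / (2 * m₁) * ‖p'‖ ^ 2 :=
    mul_le_mul_of_nonneg_right (min_le_right _ _) (sq_nonneg _)
  have hadd : 0 ≤ ‖p + p'‖ ^ 2 / (2 * m₂) := by positivity
  rw [kinetic, mul_assoc]
  linarith [mul_le_mul_of_nonneg_left (young.trans hle) hc0]
end
end

section
/- For every μ ∈ (0,1) the integral ∫_{{p ∈ ℝ⁴ : |p| < μ}} ∫_{{p' ∈ ℝ⁴ : |p'| < μ}} [ |p|² · |ln|p|| · (|p|² + |p'|²)² · |p'|² · |ln|p'|| ]^{−1} dp' dp is finite. -/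
open MeasureTheory Real
open scoped ENNReal

noncomputable section

/-- The radial profile `s / (a² + s²)²` is integrable on `(0, ∞)`, with integral `1 / (2 a²)`. -/
lemma integrableOn_and_integral_div_add_sq_sq {a : ℝ} (ha : 0 < a) :
    IntegrableOn (fun s : ℝ ↦ s / (a ^ 2 + s ^ 2) ^ 2) (Set.Ioi 0) ∧
      ∫ s in Set.Ioi (0 : ℝ), s / (a ^ 2 + s ^ 2) ^ 2 = 1 / 2 * (a ^ 2)⁻¹ := by
  have hderiv : ∀ s ∈ Set.Ici (0 : ℝ),
      HasDerivAt (fun s : ℝ ↦ -(1 / 2) * (a ^ 2 + s ^ 2)⁻¹) (s / (a ^ 2 + s ^ 2) ^ 2) s := by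
    intro s _
    have hne : a ^ 2 + s ^ 2 ≠ 0 := by positivity
    refine ((((hasDerivAt_pow 2 s).const_add (a ^ 2)).inv hne).const_mul (-(1 / 2))).congr_deriv ?_
    simp
    ring
  have hnonneg : ∀ s ∈ Set.Ioi (0 : ℝ), 0 ≤ s / (a ^ 2 + s ^ 2) ^ 2 := fun s hs ↦
    div_nonneg (le_of_lt hs) (by positivity)
  have hlim : Filter.Tendsto (fun s : ℝ ↦ -(1 / 2) * (a ^ 2 + s ^ 2)⁻¹) Filter.atTop (nhds 0) := by
    have h : Filter.Tendsto (fun s : ℝ ↦ (a ^ 2 + s ^ 2)⁻¹) Filter.atTop (nhds 0) :=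
      (Filter.tendsto_atTop_add_const_left _ _
        (Filter.tendsto_pow_atTop two_ne_zero)).inv_tendsto_atTop
    simpa only [mul_zero] using h.const_mul (-(1 / 2))
  refine ⟨integrableOn_Ioi_deriv_of_nonneg' hderiv hnonneg hlim, ?_⟩
  rw [integral_Ioi_of_hasDerivAt_of_nonneg' hderiv hnonneg hlim]
  simp

/-- On `ℝ⁴`, the integral of `[(a² + |q|²)² |q|²]⁻¹` is a constant multiple of `a⁻²`. -/
lemma exists_lintegral_add_norm_sq_sq_le :
    ∃ C : ℝ, ∀ a : ℝ, 0 < a →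
      ∫⁻ q : EuclideanSpace ℝ (Fin 4),
        ENNReal.ofReal (((a ^ 2 + ‖q‖ ^ 2) ^ 2 * ‖q‖ ^ 2)⁻¹) ≤ ENNReal.ofReal (C * (a ^ 2)⁻¹) := by
  let v := (volume : Measure (EuclideanSpace ℝ (Fin 4))).real (Metric.ball 0 1)
  refine ⟨4 * (v * (1 / 2)), fun a ha ↦ ?_⟩
  obtain ⟨hint, hval⟩ := integrableOn_and_integral_div_add_sq_sq ha
  have heq : Set.EqOn (fun s : ℝ ↦ s / (a ^ 2 + s ^ 2) ^ 2)
      (fun s ↦ s ^ (Module.finrank ℝ (EuclideanSpace ℝ (Fin 4)) - 1) •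
        ((a ^ 2 + s ^ 2) ^ 2 * s ^ 2)⁻¹) (Set.Ioi 0) := by
    intro s hs
    have hs : 0 < s := hs
    simp only [finrank_euclideanSpace, Fintype.card_fin, smul_eq_mul]
    field_simp
  have hI := (integrable_fun_norm_addHaar (volume : Measure (EuclideanSpace ℝ (Fin 4)))
    (f := fun s ↦ ((a ^ 2 + s ^ 2) ^ 2 * s ^ 2)⁻¹)).2
      ((integrableOn_congr_fun heq measurableSet_Ioi).1 hint)
  rw [← ofReal_integral_eq_lintegral_ofReal hI (ae_of_all _ fun q ↦ by positivity),
    integral_fun_norm_addHaar (volume : Measure (EuclideanSpace ℝ (Fin 4)))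
      (fun s ↦ ((a ^ 2 + s ^ 2) ^ 2 * s ^ 2)⁻¹),
    ← setIntegral_congr_fun measurableSet_Ioi heq, hval]
  refine ENNReal.ofReal_le_ofReal (le_of_eq ?_)
  simp only [finrank_euclideanSpace, Fintype.card_fin, smul_eq_mul, nsmul_eq_mul, v]
  push_cast
  ring

/-- `1 / (r ln² r)` is integrable near zero. -/
lemma integrableOn_inv_mul_log_sq {μ : ℝ} (hμ : μ < 1) :
    IntegrableOn (fun r : ℝ ↦ r⁻¹ * (Real.log r ^ 2)⁻¹) (Set.Ioo 0 μ) := by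
  have hlog : ∀ r : ℝ, 0 < r → r ≤ μ → Real.log r ≠ 0 := fun r h0 h1 ↦
    (Real.log_neg h0 (h1.trans_lt hμ)).ne
  refine (intervalIntegral.integrableOn_deriv_of_nonneg (g := fun r ↦ -(Real.log r)⁻¹)
    ?_ ?_ ?_).mono_set Set.Ioo_subset_Ioc_self
  · intro r hr
    rcases hr.1.eq_or_lt with rfl | h0
    · refine ContinuousAt.continuousWithinAt (ContinuousAt.neg ?_)
      rw [continuousAt_iff_punctured_nhds]
      simpa [Pi.inv_def] using Real.tendsto_log_nhdsNE_zero.inv_tendsto_atBot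
    · exact ((Real.continuousAt_log h0.ne').inv₀ (hlog r h0 hr.2)).neg.continuousWithinAt
  · intro r hr
    refine ((Real.hasDerivAt_log hr.1.ne').inv (hlog r hr.1 hr.2.le)).neg.congr_deriv ?_
    rw [neg_div, neg_neg, div_eq_mul_inv]
  · intro r hr
    have := hr.1
    positivity

/-- On `ℝ⁴`, the function `|p|⁻⁴ ln⁻²|p|` is integrable near the origin. -/
lemma setLIntegral_inv_norm_pow_four_log_sq_lt_top {μ : ℝ} (hμ : μ < 1) (C : ℝ) :
    ∫⁻ p in {p : EuclideanSpace ℝ (Fin 4) | ‖p‖ < μ},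
      ENNReal.ofReal ((‖p‖ ^ 2 * Real.log ‖p‖ ^ 2)⁻¹ * (C * (‖p‖ ^ 2)⁻¹)) < ⊤ := by
  have heq : Set.EqOn (fun r : ℝ ↦ C * (r⁻¹ * (Real.log r ^ 2)⁻¹))
      (fun r ↦ r ^ (Module.finrank ℝ (EuclideanSpace ℝ (Fin 4)) - 1) •
        ((r ^ 2 * Real.log r ^ 2)⁻¹ * (C * (r ^ 2)⁻¹))) (Set.Ioo 0 μ) := by
    intro r hr
    have h0 : 0 < r := hr.1
    have hl : Real.log r ≠ 0 := (Real.log_neg h0 (hr.2.trans hμ)).ne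
    simp only [finrank_euclideanSpace, Fintype.card_fin, smul_eq_mul]
    field_simp
  have hI := (integrableOn_fun_norm_addHaar (volume : Measure (EuclideanSpace ℝ (Fin 4)))
    (f := fun r ↦ (r ^ 2 * Real.log r ^ 2)⁻¹ * (C * (r ^ 2)⁻¹))).2
      ((integrableOn_congr_fun heq measurableSet_Ioo).1
        ((integrableOn_inv_mul_log_sq hμ).const_mul C))
  have hball : {p : EuclideanSpace ℝ (Fin 4) | ‖p‖ < μ} = Metric.ball 0 μ := by
    ext p
    simp
  rw [hball]
  exact hI.lintegral_lt_top

/-- The part of the kernel carrying both logarithms on one variable is integrable. -/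
lemma lintegral_one_sided_log_kernel_lt_top {μ : ℝ} (hμ : μ < 1) :
    (∫⁻ p in {p : EuclideanSpace ℝ (Fin 4) | ‖p‖ < μ},
      ∫⁻ q in {q : EuclideanSpace ℝ (Fin 4) | ‖q‖ < μ},
        ENNReal.ofReal ((‖p‖ ^ 2 * Real.log ‖p‖ ^ 2)⁻¹ *
          ((‖p‖ ^ 2 + ‖q‖ ^ 2) ^ 2 * ‖q‖ ^ 2)⁻¹)) < ⊤ := by
  obtain ⟨C, hC⟩ := exists_lintegral_add_norm_sq_sq_le
  refine lt_of_le_of_lt (lintegral_mono fun p ↦ ?_)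
    (setLIntegral_inv_norm_pow_four_log_sq_lt_top hμ C)
  rcases (norm_nonneg p).eq_or_lt with h0 | h0
  · simp [← h0]
  · have hp : 0 ≤ (‖p‖ ^ 2 * Real.log ‖p‖ ^ 2)⁻¹ := by positivity
    simp_rw [ENNReal.ofReal_mul hp]
    rw [lintegral_const_mul' _ _ ENNReal.ofReal_ne_top]
    gcongr
    exact (setLIntegral_le_lintegral _ _).trans (hC _ h0)

/-- The key four-dimensional low-momentum estimate excluding the Efimov
effect: for every `μ ∈ (0,1)` the integral
`∫∫_{|p|,|p'| < μ} [|p|² |ln|p|| (|p|²+|p'|²)² |p'|² |ln|p'||]^{-1} dp' dp`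
over `ℝ⁴ × ℝ⁴` is finite. -/
theorem low_momentum_log_kernel_integrable
    (μ : ℝ) (hμ : 0 < μ ∧ μ < 1) :
    (∫⁻ p in {p : EuclideanSpace ℝ (Fin 4) | ‖p‖ < μ},
      ∫⁻ p' in {p' : EuclideanSpace ℝ (Fin 4) | ‖p'‖ < μ},
        ENNReal.ofReal
          ((‖p‖ ^ 2 * |Real.log ‖p‖| * (‖p‖ ^ 2 + ‖p'‖ ^ 2) ^ 2 *
            ‖p'‖ ^ 2 * |Real.log ‖p'‖|)⁻¹)) < ⊤ := by
  obtain ⟨K, hKdef⟩ : ∃ K : EuclideanSpace ℝ (Fin 4) → EuclideanSpace ℝ (Fin 4) → ℝ≥0∞,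
      K = fun p q ↦ ENNReal.ofReal
        ((‖p‖ ^ 2 * Real.log ‖p‖ ^ 2)⁻¹ * ((‖p‖ ^ 2 + ‖q‖ ^ 2) ^ 2 * ‖q‖ ^ 2)⁻¹) := ⟨_, rfl⟩
  have hK : Measurable (Function.uncurry K) := by
    rw [hKdef]
    unfold Function.uncurry
    fun_prop
  have hKswap : Measurable (Function.uncurry fun p q ↦ K q p) := hK.comp measurable_swap
  have hfin : (∫⁻ p in {p : EuclideanSpace ℝ (Fin 4) | ‖p‖ < μ},
      ∫⁻ q in {q : EuclideanSpace ℝ (Fin 4) | ‖q‖ < μ}, K p q) < ⊤ := by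
    rw [hKdef]
    exact lintegral_one_sided_log_kernel_lt_top hμ.2
  have hbound : ∀ p q : EuclideanSpace ℝ (Fin 4),
      ENNReal.ofReal ((‖p‖ ^ 2 * |Real.log ‖p‖| * (‖p‖ ^ 2 + ‖q‖ ^ 2) ^ 2 *
        ‖q‖ ^ 2 * |Real.log ‖q‖|)⁻¹) ≤ K p q + K q p := by
    intro p q
    simp only [hKdef]
    rw [← ENNReal.ofReal_add (by positivity) (by positivity)]
    refine ENNReal.ofReal_le_ofReal ?_
    have hxy : |Real.log ‖p‖|⁻¹ * |Real.log ‖q‖|⁻¹ ≤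
        (|Real.log ‖p‖|⁻¹) ^ 2 + (|Real.log ‖q‖|⁻¹) ^ 2 := by
      nlinarith [sq_nonneg (|Real.log ‖p‖|⁻¹ - |Real.log ‖q‖|⁻¹),
        sq_nonneg (|Real.log ‖p‖|⁻¹), sq_nonneg (|Real.log ‖q‖|⁻¹)]
    have hw : 0 ≤ (‖p‖ ^ 2)⁻¹ * ((‖p‖ ^ 2 + ‖q‖ ^ 2) ^ 2)⁻¹ * (‖q‖ ^ 2)⁻¹ := by positivity
    have := mul_le_mul_of_nonneg_left hxy hw
    rw [← sq_abs (Real.log ‖p‖), ← sq_abs (Real.log ‖q‖), add_comm (‖q‖ ^ 2) (‖p‖ ^ 2)]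
    simp only [mul_inv, ← inv_pow] at this ⊢
    linarith
  calc _ ≤ ∫⁻ p in {p : EuclideanSpace ℝ (Fin 4) | ‖p‖ < μ},
        ∫⁻ q in {q : EuclideanSpace ℝ (Fin 4) | ‖q‖ < μ}, (K p q + K q p) :=
        lintegral_mono fun p ↦ lintegral_mono fun q ↦ hbound p q
    _ = (∫⁻ p in {p : EuclideanSpace ℝ (Fin 4) | ‖p‖ < μ},
          ∫⁻ q in {q : EuclideanSpace ℝ (Fin 4) | ‖q‖ < μ}, K p q) +
        ∫⁻ p in {p : EuclideanSpace ℝ (Fin 4) | ‖p‖ < μ},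
          ∫⁻ q in {q : EuclideanSpace ℝ (Fin 4) | ‖q‖ < μ}, K q p := by
        refine Eq.trans ?_ (lintegral_add_left hK.lintegral_prod_right' _)
        exact lintegral_congr fun p ↦ lintegral_add_left (hK.comp measurable_prodMk_left) _
    _ < ⊤ := by
        rw [lintegral_lintegral_swap hKswap.aemeasurable]
        exact ENNReal.add_lt_top.2 ⟨hfin, hfin⟩
end
end
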